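/- Barr–Wells's Surcategorical Theorem: Let (𝓒, A) be a surcategory over 𝔾 which is surcomplete, surcocomplete, and has K-equalizers, and let T be a surmonad on (𝓒, A) which preserves κ-filtered surcolimits (𝕁-surcolimits with 𝕁 a κ-filtered small category) for some regular cardinal κ. Then the surcategory (𝓒^T, A) of suralgebras is surcomplete, surcocomplete, and has K-equalizers. -/

import Mathlib

open CategoryTheory CategoryTheory.Limits CategoryTheory.MonoidalCategory

universe w w' v u v₁ u₁ v₂ u₂ v₃ u₃ v₄ u₄

namespace Sur

variable {G : Type u} [Category.{v} G]

section Basic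

variable {E : Type u₁} [Category.{v₁} E]

/-- A diagram whose composite with the arity functor is constant at `B`. -/
structure ArityConst (A : E ⥤ G) {J : Type w} [Category.{w'} J] (F : J ⥤ E) (B : G) : Prop where
  obj_eq : ∀ j, A.obj (F.obj j) = B
  map_eq : ∀ {j j'} (f : j ⟶ j'),
    A.map (F.map f) = eqToHom ((obj_eq j).trans (obj_eq j').symm)

/-- A surcone on a diagram whose arity is constant at `B`: a cone together with an arity
morphism under which all legs lie. -/
structure Surcone (A : E ⥤ G) {J : Type w} [Category.{w'} J] (F : J ⥤ E) (B : G)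
    (h : ∀ j, A.obj (F.obj j) = B) where
  pt : E
  leg : ∀ j, pt ⟶ F.obj j
  w : ∀ {j j'} (f : j ⟶ j'), leg j ≫ F.map f = leg j'
  arity : A.obj pt ⟶ B
  fac : ∀ j, A.map (leg j) ≫ eqToHom (h j) = arity

/-- A surcone is a surlimit if its apex is in the fiber over `B`, its arity is the identity,
and every surcone factors through it by a unique morphism. -/
structure IsSurlimit (A : E ⥤ G) {J : Type w} [Category.{w'} J] {F : J ⥤ E} {B : G}
    {h : ∀ j, A.obj (F.obj j) = B} (c : Surcone A F B h) : Prop where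
  pt_eq : A.obj c.pt = B
  arity_eq : c.arity = eqToHom pt_eq
  lift : ∀ c' : Surcone A F B h, ∃! f : c'.pt ⟶ c.pt,
    (∀ j, f ≫ c.leg j = c'.leg j) ∧ A.map f ≫ eqToHom pt_eq = c'.arity

/-- `(E, A)` has `J`-surlimits. -/
def HasSurlimitsOfShape (A : E ⥤ G) (J : Type w) [Category.{w'} J] : Prop :=
  ∀ (F : J ⥤ E) (B : G) (hc : ArityConst A F B),
    ∃ c : Surcone A F B hc.obj_eq, IsSurlimit A c

/-- Dual notion : surcocone. -/
structure Surcocone (A : E ⥤ G) {J : Type w} [Category.{w'} J] (F : J ⥤ E) (B : G)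
    (h : ∀ j, A.obj (F.obj j) = B) where
  pt : E
  leg : ∀ j, F.obj j ⟶ pt
  w : ∀ {j j'} (f : j ⟶ j'), F.map f ≫ leg j' = leg j
  arity : B ⟶ A.obj pt
  fac : ∀ j, eqToHom (h j).symm ≫ A.map (leg j) = arity

structure IsSurcolimit (A : E ⥤ G) {J : Type w} [Category.{w'} J] {F : J ⥤ E} {B : G}
    {h : ∀ j, A.obj (F.obj j) = B} (c : Surcocone A F B h) : Prop where
  pt_eq : A.obj c.pt = B
  arity_eq : c.arity = eqToHom pt_eq.symm
  desc : ∀ c' : Surcocone A F B h, ∃! f : c.pt ⟶ c'.pt,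
    (∀ j, c.leg j ≫ f = c'.leg j) ∧ eqToHom pt_eq.symm ≫ A.map f = c'.arity

def HasSurcolimitsOfShape (A : E ⥤ G) (J : Type w) [Category.{w'} J] : Prop :=
  ∀ (F : J ⥤ E) (B : G) (hc : ArityConst A F B),
    ∃ c : Surcocone A F B hc.obj_eq, IsSurcolimit A c

/-- `(E, A)` has K-equalizers : every parallel pair with equal arity image has an equalizer
lying over an identity of the base. -/
def HasKEqualizers (A : E ⥤ G) : Prop :=
  ∀ ⦃a b : E⦄ (f g : a ⟶ b), A.map f = A.map g →
    ∃ (c : E) (e : c ⟶ a) (hc : A.obj c = A.obj a),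
      A.map e = eqToHom hc ∧ e ≫ f = e ≫ g ∧
      ∀ ⦃d : E⦄ (k : d ⟶ a), k ≫ f = k ≫ g → ∃! l : d ⟶ c, l ≫ e = k

/-- `e` is a surcoequalizer of the pair `(f, g)`. -/
def IsSurcoequalizer (A : E ⥤ G) {a b c : E} (f g : a ⟶ b) (e : b ⟶ c) : Prop :=
  ∃ h : A.obj b = A.obj c, A.map e = eqToHom h ∧ f ≫ e = g ≫ e ∧
    ∀ ⦃d : E⦄ (k : b ⟶ d), f ≫ k = g ≫ k → ∃! l : c ⟶ d, e ≫ l = k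

/-- `(E, A)` has surcoequalizers of all parallel pairs lying in one fiber. -/
def HasSurcoequalizers (A : E ⥤ G) : Prop :=
  ∀ ⦃a b : E⦄ (f g : a ⟶ b) (hab : A.obj a = A.obj b),
    A.map f = eqToHom hab → A.map g = eqToHom hab →
    ∃ (c : E) (e : b ⟶ c), IsSurcoequalizer A f g e

/-- `(E, A)` has surequalizers of all parallel pairs lying in one fiber. -/
def HasSurequalizers (A : E ⥤ G) : Prop :=
  ∀ ⦃a b : E⦄ (f g : a ⟶ b) (hab : A.obj a = A.obj b),
    A.map f = eqToHom hab → A.map g = eqToHom hab →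
    ∃ (c : E) (e : c ⟶ a) (hc : A.obj c = A.obj a),
      A.map e = eqToHom hc ∧ e ≫ f = e ≫ g ∧
      ∀ ⦃d : E⦄ (k : d ⟶ a), k ≫ f = k ≫ g → ∃! l : d ⟶ c, l ≫ e = k

/-- A split surfork : a split fork lying entirely in one fiber. -/
def IsSplitSurfork (A : E ⥤ G) {a b c : E} (f g : a ⟶ b) (h : b ⟶ c) : Prop :=
  (∃ hab : A.obj a = A.obj b, A.map f = eqToHom hab ∧ A.map g = eqToHom hab) ∧
  (∃ hbc : A.obj b = A.obj c, A.map h = eqToHom hbc) ∧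
  f ≫ h = g ≫ h ∧
  ∃ (s : c ⟶ b) (t : b ⟶ a),
    (∃ hcb : A.obj c = A.obj b, A.map s = eqToHom hcb) ∧
    (∃ hba : A.obj b = A.obj a, A.map t = eqToHom hba) ∧
    s ≫ h = 𝟙 c ∧ t ≫ f = 𝟙 b ∧ t ≫ g = h ≫ s

/-- A surinitial object in the fiber over `Gobj`. -/
def Surinitial (A : E ⥤ G) (Gobj : G) (x : E) : Prop :=
  ∃ hx : A.obj x = Gobj, ∀ (d : E) (h : Gobj ⟶ A.obj d),
    ∃! f : x ⟶ d, A.map f = eqToHom hx ≫ h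

/-- A surmonad : a monad whose underlying functor, unit and multiplication lie over
identities of the base. -/
structure IsSurmonad (A : E ⥤ G) (T : Monad E) : Prop where
  sur : T.toFunctor ⋙ A = A
  unit_arity : ∀ X : E, A.map (T.η.app X) = eqToHom (Functor.congr_obj sur X).symm
  mul_arity : ∀ X : E, A.map (T.μ.app X) = eqToHom (Functor.congr_obj sur (T.obj X))

end Basic

section Two

variable {E : Type u₁} [Category.{v₁} E] {E' : Type u₂} [Category.{v₂} E']

/-- An absolute surcoequalizer : a surcoequalizer preserved by every surfunctor. -/
def IsAbsoluteSurcoequalizer.{ua, va, ug, vg, ue, ve} {Gb : Type ug} [Category.{vg} Gb]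
    {Eb : Type ue} [Category.{ve} Eb] (A : Eb ⥤ Gb) {a b c : Eb}
    (f g : a ⟶ b) (e : b ⟶ c) : Prop :=
  IsSurcoequalizer A f g e ∧
  ∀ (D : Type ua) [Category.{va} D] (A' : D ⥤ Gb) (Fc : Eb ⥤ D),
    Fc ⋙ A' = A → IsSurcoequalizer A' (Fc.map f) (Fc.map g) (Fc.map e)

/-- The image of a surcone under a surfunctor. -/
def Surcone.map {A : E ⥤ G} {A' : E' ⥤ G} (Fc : E ⥤ E') (hsur : Fc ⋙ A' = A)
    {J : Type w} [Category.{w'} J] {D : J ⥤ E} {B : G} {h : ∀ j, A.obj (D.obj j) = B}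
    (c : Surcone A D B h) :
    Surcone A' (D ⋙ Fc) B (fun j => (Functor.congr_obj hsur (D.obj j)).trans (h j)) where
  pt := Fc.obj c.pt
  leg j := Fc.map (c.leg j)
  w {j j'} f := by
    dsimp only [Functor.comp_map]
    rw [← Fc.map_comp, c.w f]
  arity := eqToHom (Functor.congr_obj hsur c.pt) ≫ c.arity
  fac j := by
    have h1 := Functor.congr_hom hsur (c.leg j)
    dsimp only [Functor.comp_map] at h1
    rw [h1, Category.assoc, Category.assoc, eqToHom_trans, c.fac j]

/-- The image of a surcocone under a surfunctor. -/
def Surcocone.map {A : E ⥤ G} {A' : E' ⥤ G} (Fc : E ⥤ E') (hsur : Fc ⋙ A' = A)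
    {J : Type w} [Category.{w'} J] {D : J ⥤ E} {B : G} {h : ∀ j, A.obj (D.obj j) = B}
    (c : Surcocone A D B h) :
    Surcocone A' (D ⋙ Fc) B (fun j => (Functor.congr_obj hsur (D.obj j)).trans (h j)) where
  pt := Fc.obj c.pt
  leg j := Fc.map (c.leg j)
  w {j j'} f := by
    dsimp only [Functor.comp_map]
    rw [← Fc.map_comp, c.w f]
  arity := c.arity ≫ eqToHom (Functor.congr_obj hsur c.pt).symm
  fac j := by
    have h1 := Functor.congr_hom hsur (c.leg j)
    dsimp only [Functor.comp_map] at h1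
    rw [h1, eqToHom_trans_assoc, ← Category.assoc, c.fac j]

/-- A surfunctor preserves `J`-surlimits. -/
def PreservesSurlimitsOfShape {A : E ⥤ G} {A' : E' ⥤ G} (Fc : E ⥤ E') (hsur : Fc ⋙ A' = A)
    (J : Type w) [Category.{w'} J] : Prop :=
  ∀ (D : J ⥤ E) (B : G) (hc : ArityConst A D B) (c : Surcone A D B hc.obj_eq),
    IsSurlimit A c → IsSurlimit A' (c.map Fc hsur)

/-- A surfunctor preserves `J`-surcolimits. -/
def PreservesSurcolimitsOfShape {A : E ⥤ G} {A' : E' ⥤ G} (Fc : E ⥤ E') (hsur : Fc ⋙ A' = A)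
    (J : Type w) [Category.{w'} J] : Prop :=
  ∀ (D : J ⥤ E) (B : G) (hc : ArityConst A D B) (c : Surcocone A D B hc.obj_eq),
    IsSurcolimit A c → IsSurcolimit A' (c.map Fc hsur)

/-- A surfunctor preserves K-equalizers. -/
def PreservesKEqualizers {A : E ⥤ G} {A' : E' ⥤ G} (Fc : E ⥤ E')
    (_hsur : Fc ⋙ A' = A) : Prop :=
  ∀ ⦃a b c : E⦄ (f g : a ⟶ b) (e : c ⟶ a) (hc : A.obj c = A.obj a),
    A.map f = A.map g → A.map e = eqToHom hc → e ≫ f = e ≫ g →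
    (∀ ⦃d : E⦄ (k : d ⟶ a), k ≫ f = k ≫ g → ∃! l : d ⟶ c, l ≫ e = k) →
    (Fc.map e ≫ Fc.map f = Fc.map e ≫ Fc.map g ∧
     ∀ ⦃d : E'⦄ (k : d ⟶ Fc.obj a), k ≫ Fc.map f = k ≫ Fc.map g →
       ∃! l : d ⟶ Fc.obj c, l ≫ Fc.map e = k)

/-- A suradjunction : an adjunction between surfunctors whose unit and counit lie over
identities of the base. -/
structure IsSuradjunction (A' : E' ⥤ G) (A : E ⥤ G) (Fl : E' ⥤ E) (Fr : E ⥤ E')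
    (adj : Fl ⊣ Fr) : Prop where
  left_sur : Fl ⋙ A = A'
  right_sur : Fr ⋙ A' = A
  unit_arity : ∀ X : E', A'.map (adj.unit.app X) =
    eqToHom (((Functor.congr_obj right_sur (Fl.obj X)).trans (Functor.congr_obj left_sur X)).symm)
  counit_arity : ∀ Y : E, A.map (adj.counit.app Y) =
    eqToHom ((Functor.congr_obj left_sur (Fr.obj Y)).trans (Functor.congr_obj right_sur Y))

/-- `U` creates surcoequalizers of the parallel pair `(f, g)`. -/
def CreatesSurcoequalizersOf (A : E ⥤ G) (A' : E' ⥤ G) (U : E ⥤ E')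
    {a b : E} (f g : a ⟶ b) : Prop :=
  ∀ (c : E') (e : U.obj b ⟶ c), IsSurcoequalizer A' (U.map f) (U.map g) e →
    ∃ (z : E) (q : b ⟶ z) (hz : U.obj z = c),
      U.map q = e ≫ eqToHom hz.symm ∧ IsSurcoequalizer A f g q ∧
      ∀ (z' : E) (q' : b ⟶ z') (hz' : U.obj z' = c),
        U.map q' = e ≫ eqToHom hz'.symm →
        ∃ hzz : z = z', q' = q ≫ eqToHom hzz

/-- The solution set condition for an object `B` relative to a surfunctor `Fc`. -/
def SolutionSet (A' : E' ⥤ G) (Fc : E ⥤ E') (B : E') : Prop :=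
  ∃ (I : Type w) (obj : I → E) (bi : ∀ i, B ⟶ Fc.obj (obj i))
    (hι : ∀ i, A'.obj B = A'.obj (Fc.obj (obj i))),
    (∀ i, A'.map (bi i) = eqToHom (hι i)) ∧
    ∀ (a : E) (b : B ⟶ Fc.obj a), ∃ (i : I) (x : obj i ⟶ a), bi i ≫ Fc.map x = b

/-- A fusionnable suradjunction (condition on the right adjoint surfunctor `U`). -/
def Fusionnable {Ac : E ⥤ G} {Ab : E' ⥤ G} (U : E ⥤ E') (hU : U ⋙ Ab = Ac) : Prop :=
  HasSurcoequalizers Ac ∧ HasSurcolimitsOfShape Ac ℕ ∧ HasSurcolimitsOfShape Ab ℕ ∧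
  U.Faithful ∧ PreservesSurcolimitsOfShape U hU ℕ

/-- A `κ`-filtered category : every diagram of size `< κ` admits a cocone. -/
def IsCardinalFilteredCat (J : Type w) [Category.{w} J] (κ : Cardinal.{w}) : Prop :=
  ∀ (K : Type w) [SmallCategory K], Cardinal.mk K < κ →
    Cardinal.mk ((k : K) × (k' : K) × (k ⟶ k')) < κ →
    ∀ D : K ⥤ J, ∃ (j : J) (cc : ∀ k, D.obj k ⟶ j),
      ∀ {k k'} (f : k ⟶ k'), D.map f ≫ cc k' = cc k

end Two

section Pullback

variable {E : Type u₁} [Category.{v₁} E] {E' : Type u₂} [Category.{v₂} E']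
  {Bc : Type u₃} [Category.{v₃} Bc]

/-- The strict pullback of two functors `U : E ⥤ Bc` and `V : E' ⥤ Bc`. -/
structure CatPullback (U : E ⥤ Bc) (V : E' ⥤ Bc) where
  left : E
  right : E'
  eq : U.obj left = V.obj right

@[ext]
structure CatPullbackHom (U : E ⥤ Bc) (V : E' ⥤ Bc) (X Y : CatPullback U V) where
  left : X.left ⟶ Y.left
  right : X.right ⟶ Y.right
  w : U.map left = eqToHom X.eq ≫ V.map right ≫ eqToHom Y.eq.symm

instance (U : E ⥤ Bc) (V : E' ⥤ Bc) : Category (CatPullback U V) where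
  Hom X Y := CatPullbackHom U V X Y
  id X := ⟨𝟙 _, 𝟙 _, by simp⟩
  comp f g := ⟨f.left ≫ g.left, f.right ≫ g.right, by simp [f.w, g.w]⟩
  id_comp f := by apply CatPullbackHom.ext <;> simp [CategoryStruct.comp, CategoryStruct.id]
  comp_id f := by apply CatPullbackHom.ext <;> simp [CategoryStruct.comp, CategoryStruct.id]
  assoc f g h := by apply CatPullbackHom.ext <;> simp [CategoryStruct.comp]

/-- The canonical functor from the strict pullback of `U` and `V` to their common codomain. -/
def Ofun (U : E ⥤ Bc) (V : E' ⥤ Bc) : CatPullback U V ⥤ Bc where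
  obj X := U.obj X.left
  map f := U.map f.left
  map_id X := by
    show U.map (𝟙 X.left) = _
    simp
  map_comp f g := by
    show U.map (_ ≫ _) = _
    simp

/-- The arity functor on the comma category `B ↓ Fc` of a surfunctor `Fc`. -/
def commaArity {A : E ⥤ G} {A' : E' ⥤ G} (Fc : E ⥤ E') (hsur : Fc ⋙ A' = A) (B : E') :
    StructuredArrow B Fc ⥤ Under (A'.obj B) where
  obj p := Under.mk (A'.map p.hom ≫ eqToHom (Functor.congr_obj hsur p.right))
  map {p q} f := Under.homMk (A.map f.right) (by
    have hw : p.hom ≫ Fc.map f.right = q.hom := StructuredArrow.w f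
    have h1 := Functor.congr_hom hsur f.right
    dsimp only [Functor.comp_map] at h1
    dsimp [Under.mk]
    have h2 : eqToHom (Functor.congr_obj hsur p.right) ≫ A.map f.right
        = A'.map (Fc.map f.right) ≫ eqToHom (Functor.congr_obj hsur q.right) := by
      rw [h1]; simp
    rw [Category.assoc, h2, ← Category.assoc, ← A'.map_comp, hw])

end Pullback

section Closure

universe t

variable {D : Type u₁} [Category.{v₁} D]

/-- Every `J`-shaped diagram of objects satisfying `P` has a colimit satisfying `P`. -/
def HasColimitsIn (P : ObjectProperty D) (J : Type w) [Category.{w'} J] : Prop :=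
  ∀ F : J ⥤ D, (∀ j, P (F.obj j)) → ∃ c : Cocone F, Nonempty (IsColimit c) ∧ P c.pt

lemma HasColimitsIn.of_equivalence {P : ObjectProperty D} {J : Type w} [Category.{w'} J]
    (h : HasColimitsIn P J) {K : Type v₂} [Category.{u₂} K] (e : K ≌ J) : HasColimitsIn P K := by
  intro F hF
  obtain ⟨c, ⟨hc⟩, hP⟩ := h (e.inverse ⋙ F) (fun _ => hF _)
  exact ⟨(Cocone.precompose (e.funInvIdAssoc F).inv).obj (c.whisker e.functor),
    ⟨(IsColimit.precomposeInvEquiv (e.funInvIdAssoc F) _).symm (hc.whiskerEquivalence e)⟩, hP⟩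

lemma HasColimitsIn.hasColimitsOfShape {P : ObjectProperty D} {J : Type w} [Category.{w'} J]
    (h : HasColimitsIn P J) : HasColimitsOfShape J P.FullSubcategory where
  has_colimit F := by
    obtain ⟨c, ⟨hc⟩, hP⟩ := h (F ⋙ P.ι) (fun j => (F.obj j).property)
    let d : Cocone F :=
      { pt := ⟨c.pt, hP⟩
        ι := { app := fun j => ObjectProperty.homMk (c.ι.app j)
               naturality := fun i j f => by
                ext; exact c.ι.naturality f } }
    have hd : IsColimit (P.ι.mapCocone d) := hc
    exact ⟨⟨d, isColimitOfReflects P.ι hd⟩⟩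

lemma HasColimitsIn.preservesColimitsOfShape {P : ObjectProperty D} {J : Type w} [Category.{w'} J]
    (h : HasColimitsIn P J) : PreservesColimitsOfShape J P.ι where
  preservesColimit {F} := by
    obtain ⟨c, ⟨hc⟩, hP⟩ := h (F ⋙ P.ι) (fun j => (F.obj j).property)
    let d : Cocone F :=
      { pt := ⟨c.pt, hP⟩
        ι := { app := fun j => ObjectProperty.homMk (c.ι.app j)
               naturality := fun i j f => by
                ext; exact c.ι.naturality f } }
    have hd : IsColimit (P.ι.mapCocone d) := hc
    exact preservesColimit_of_preserves_colimit_cocone (isColimitOfReflects P.ι hd) hd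

/-- If every object satisfying `P` is the source of a morphism of `W` whose target satisfies `P`,
these morphisms can be composed transfinitely. -/
lemma HasColimitsIn.exists_transfiniteComposition {P : ObjectProperty D}
    (hP : ∀ (K : Type t) [SmallCategory K], HasColimitsIn P K) (W : MorphismProperty D)
    (hW : ∀ Z, P Z → ∃ (Z' : D) (f : Z ⟶ Z'), P Z' ∧ W f)
    (J : Type t) [LinearOrder J] [SuccOrder J] [OrderBot J] [WellFoundedLT J]
    {Z₀ : D} (h₀ : P Z₀) :
    ∃ (Z : D) (f : Z₀ ⟶ Z) (h : W.TransfiniteCompositionOfShape J f),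
      P Z ∧ ∀ j, P (h.F.obj j) := by
  have (K : Type t) [SmallCategory K] : HasColimitsOfShape K P.FullSubcategory :=
    (hP K).hasColimitsOfShape
  have (K : Type t) [SmallCategory K] : PreservesColimitsOfShape K P.ι :=
    (hP K).preservesColimitsOfShape
  have : HasIterationOfShape J P.FullSubcategory := { }
  have : PreservesWellOrderContinuousOfShape J P.ι := { }
  choose Z' f hZ' hf using hW
  let Φ : SmallObject.SuccStruct P.FullSubcategory :=
    { X₀ := ⟨Z₀, h₀⟩
      succ := fun Z => ⟨Z' Z.obj Z.property, hZ' _ _⟩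
      toSucc := fun Z => ObjectProperty.homMk (f Z.obj Z.property) }
  have hΦ : Φ.prop ≤ W.inverseImage P.ι := by
    rintro _ _ _ ⟨Z⟩
    exact hf _ _
  exact ⟨_, _, ((Φ.transfiniteCompositionOfShapeιIteration J).ofLE hΦ).map,
    (Φ.iteration J).property, fun j => ((Φ.iterationFunctor J).obj j).property⟩

end Closure

section Presentation

variable {D : Type u₁} [Category.{v₁} D]

/-- Generators `gen` and relators `rel` for an algebra over an endofunctor `T`: a relator `r`
imposes that the term `term r` takes the value `val r`. -/
structure Presentation (T : D ⥤ D) where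
  gen : D
  rel : D
  val : rel ⟶ gen
  term : rel ⟶ T.obj gen

namespace Presentation

/-- Morphisms of presentations. -/
@[ext]
structure Hom {T : D ⥤ D} (Z Z' : Presentation T) where
  gen : Z.gen ⟶ Z'.gen
  rel : Z.rel ⟶ Z'.rel
  val_comm : Z.val ≫ gen = rel ≫ Z'.val
  term_comm : Z.term ≫ T.map gen = rel ≫ Z'.term

lemma Hom.val_comm_assoc {T : D ⥤ D} {Z Z' : Presentation T} (f : Hom Z Z') {Y : D}
    (k : Z'.gen ⟶ Y) : Z.val ≫ f.gen ≫ k = f.rel ≫ Z'.val ≫ k := by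
  rw [← Category.assoc, f.val_comm, Category.assoc]

lemma Hom.term_comm_assoc {T : D ⥤ D} {Z Z' : Presentation T} (f : Hom Z Z') {Y : D}
    (k : T.obj Z'.gen ⟶ Y) : Z.term ≫ T.map f.gen ≫ k = f.rel ≫ Z'.term ≫ k := by
  rw [← Category.assoc, f.term_comm, Category.assoc]

instance (T : D ⥤ D) : Category (Presentation T) where
  Hom Z Z' := Hom Z Z'
  id Z := ⟨𝟙 _, 𝟙 _, by simp, by simp⟩
  comp f g := ⟨f.gen ≫ g.gen, f.rel ≫ g.rel,
    by rw [f.val_comm_assoc, g.val_comm, Category.assoc],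
    by rw [T.map_comp, f.term_comm_assoc, g.term_comm, Category.assoc]⟩
  id_comp f := Hom.ext (Category.id_comp f.gen) (Category.id_comp f.rel)
  comp_id f := Hom.ext (Category.comp_id f.gen) (Category.comp_id f.rel)
  assoc f g h := Hom.ext (Category.assoc f.gen g.gen h.gen) (Category.assoc f.rel g.rel h.rel)

variable {T : D ⥤ D}

@[ext]
lemma hom_ext {Z Z' : Presentation T} {f g : Z ⟶ Z'} (h : f.gen = g.gen) (h' : f.rel = g.rel) :
    f = g := Hom.ext h h'

@[simp]
lemma comp_gen {Z Z' Z'' : Presentation T} (f : Z ⟶ Z') (g : Z' ⟶ Z'') :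
    (f ≫ g).gen = f.gen ≫ g.gen := rfl

@[simp]
lemma comp_rel {Z Z' Z'' : Presentation T} (f : Z ⟶ Z') (g : Z' ⟶ Z'') :
    (f ≫ g).rel = f.rel ≫ g.rel := rfl

@[simp] lemma id_gen (Z : Presentation T) : (𝟙 Z : Z ⟶ Z).gen = 𝟙 Z.gen := rfl

@[simp] lemma id_rel (Z : Presentation T) : (𝟙 Z : Z ⟶ Z).rel = 𝟙 Z.rel := rfl

variable (T) in
/-- The functor sending a presentation to its generators. -/
abbrev genFunctor : Presentation T ⥤ D where
  obj Z := Z.gen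
  map f := f.gen

variable (T) in
/-- The functor sending a presentation to its relators. -/
abbrev relFunctor : Presentation T ⥤ D where
  obj Z := Z.rel
  map f := f.rel

/-- The presentations whose generators and relators satisfy `P`. -/
def lift (T : D ⥤ D) (P : ObjectProperty D) : ObjectProperty (Presentation T) :=
  fun Z => P Z.gen ∧ P Z.rel

section Colimit

variable {J : Type w} [Category.{w'} J] {F : J ⥤ Presentation T}
  {c : Cocone (F ⋙ genFunctor T)} {d : Cocone (F ⋙ relFunctor T)}

lemma val_naturality (c : Cocone (F ⋙ genFunctor T)) {i j : J} (f : i ⟶ j) :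
    (F.map f).rel ≫ (F.obj j).val ≫ c.ι.app j = ((F.obj i).val ≫ c.ι.app i) ≫ 𝟙 _ := by
  have h : (F.map f).gen ≫ c.ι.app j = c.ι.app i := c.w f
  rw [← (F.map f).val_comm_assoc, h, Category.comp_id]

lemma term_naturality (c : Cocone (F ⋙ genFunctor T)) {i j : J} (f : i ⟶ j) :
    (F.map f).rel ≫ (F.obj j).term ≫ T.map (c.ι.app j) =
      ((F.obj i).term ≫ T.map (c.ι.app i)) ≫ 𝟙 _ := by
  have h : (F.map f).gen ≫ c.ι.app j = c.ι.app i := c.w f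
  rw [← (F.map f).term_comm_assoc, ← T.map_comp, h, Category.comp_id]

/-- The cocone of relators obtained by evaluating in a cocone of generators. -/
abbrev valCocone (c : Cocone (F ⋙ genFunctor T)) : Cocone (F ⋙ relFunctor T) where
  pt := c.pt
  ι :=
    { app := fun j => (F.obj j).val ≫ c.ι.app j
      naturality := fun _ _ f => val_naturality c f }

/-- The cocone of relators obtained by taking terms in a cocone of generators. -/
abbrev termCocone (c : Cocone (F ⋙ genFunctor T)) : Cocone (F ⋙ relFunctor T) where
  pt := T.obj c.pt
  ι :=
    { app := fun j => (F.obj j).term ≫ T.map (c.ι.app j)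
      naturality := fun _ _ f => term_naturality c f }

/-- The cocone of presentations on cocones of generators and relators. -/
abbrev cocone (c : Cocone (F ⋙ genFunctor T)) (hd : IsColimit d) : Cocone F where
  pt :=
    { gen := c.pt
      rel := d.pt
      val := hd.desc (valCocone c)
      term := hd.desc (termCocone c) }
  ι :=
    { app := fun j => ⟨c.ι.app j, d.ι.app j, (hd.fac (valCocone c) j).symm,
        (hd.fac (termCocone c) j).symm⟩
      naturality := fun _ _ f => hom_ext (c.ι.naturality f) (d.ι.naturality f) }

/-- Colimits of presentations are computed on generators and on relators. -/
def isColimitCocone (hc : IsColimit c) (hd : IsColimit d) : IsColimit (cocone c hd) where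
  desc s :=
    { gen := hc.desc ((genFunctor T).mapCocone s)
      rel := hd.desc ((relFunctor T).mapCocone s)
      val_comm := hd.hom_ext fun j => by
        have h : c.ι.app j ≫ hc.desc ((genFunctor T).mapCocone s) = (s.ι.app j).gen := hc.fac _ j
        have h' : d.ι.app j ≫ hd.desc ((relFunctor T).mapCocone s) = (s.ι.app j).rel := hd.fac _ j
        rw [hd.fac_assoc, reassoc_of% h', Category.assoc, h, (s.ι.app j).val_comm]
        rfl
      term_comm := hd.hom_ext fun j => by
        have h : c.ι.app j ≫ hc.desc ((genFunctor T).mapCocone s) = (s.ι.app j).gen := hc.fac _ j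
        have h' : d.ι.app j ≫ hd.desc ((relFunctor T).mapCocone s) = (s.ι.app j).rel := hd.fac _ j
        rw [hd.fac_assoc, reassoc_of% h', Category.assoc, ← T.map_comp, h,
          (s.ι.app j).term_comm]
        rfl }
  fac s j := hom_ext (hc.fac ((genFunctor T).mapCocone s) j)
    (hd.fac ((relFunctor T).mapCocone s) j)
  uniq s m hm := hom_ext
    (hc.uniq ((genFunctor T).mapCocone s) _ fun j => congrArg Hom.gen (hm j))
    (hd.uniq ((relFunctor T).mapCocone s) _ fun j => congrArg Hom.rel (hm j))

lemma hasColimitsIn_lift {P : ObjectProperty D} (h : HasColimitsIn P J) :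
    HasColimitsIn (lift T P) J := by
  intro F hF
  obtain ⟨c, ⟨hc⟩, hcP⟩ := h (F ⋙ genFunctor T) (fun j => (hF j).1)
  obtain ⟨d, ⟨hd⟩, hdP⟩ := h (F ⋙ relFunctor T) (fun j => (hF j).2)
  exact ⟨cocone c hd, ⟨isColimitCocone hc hd⟩, hcP, hdP⟩

lemma preservesColimit_genFunctor {P : ObjectProperty D} (h : HasColimitsIn P J)
    (hF : ∀ j, lift T P (F.obj j)) : PreservesColimit F (genFunctor T) := by
  obtain ⟨c, ⟨hc⟩, -⟩ := h (F ⋙ genFunctor T) (fun j => (hF j).1)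
  obtain ⟨d, ⟨hd⟩, -⟩ := h (F ⋙ relFunctor T) (fun j => (hF j).2)
  exact preservesColimit_of_preserves_colimit_cocone (isColimitCocone hc hd)
    (IsColimit.ofIsoColimit hc (Cocone.ext (Iso.refl _) fun _ => Category.comp_id _))

lemma preservesColimit_relFunctor {P : ObjectProperty D} (h : HasColimitsIn P J)
    (hF : ∀ j, lift T P (F.obj j)) : PreservesColimit F (relFunctor T) := by
  obtain ⟨c, ⟨hc⟩, -⟩ := h (F ⋙ genFunctor T) (fun j => (hF j).1)
  obtain ⟨d, ⟨hd⟩, -⟩ := h (F ⋙ relFunctor T) (fun j => (hF j).2)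
  exact preservesColimit_of_preserves_colimit_cocone (isColimitCocone hc hd)
    (IsColimit.ofIsoColimit hd (Cocone.ext (Iso.refl _) fun _ => Category.comp_id _))

end Colimit

end Presentation

end Presentation

section Reflection

universe t

variable {D : Type u₁} [Category.{v₁} D] {T : Monad D}

namespace Presentation

/-- The canonical presentation of an algebra. -/
abbrev ofAlgebra (M : T.Algebra) : Presentation T.toFunctor where
  gen := M.A
  rel := T.obj M.A
  val := M.a
  term := 𝟙 _

variable (T) in
/-- The canonical presentations of algebras. -/
def algebras : ObjectProperty (Presentation T.toFunctor) := fun Z => ∃ M, Z = ofAlgebra M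

lemma rel_eq {Z : Presentation T.toFunctor} {M : T.Algebra} (f : Z ⟶ ofAlgebra M) :
    f.rel = Z.term ≫ T.map f.gen := by
  rw [f.term_comm, Category.comp_id]

lemma val_comp_gen {Z : Presentation T.toFunctor} {M : T.Algebra} (f : Z ⟶ ofAlgebra M) :
    Z.val ≫ f.gen = Z.term ≫ T.map f.gen ≫ M.a := by
  rw [f.val_comm, rel_eq f, Category.assoc]

/-- A model in `M` of the presentation `Z`, as a morphism of presentations. -/
abbrev toOfAlgebra {Z : Presentation T.toFunctor} {M : T.Algebra} (g : Z.gen ⟶ M.A)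
    (h : Z.val ≫ g = Z.term ≫ T.map g ≫ M.a) : Z ⟶ ofAlgebra M where
  gen := g
  rel := Z.term ≫ T.map g
  val_comm := h.trans (Category.assoc _ _ _).symm
  term_comm := (Category.comp_id _).symm

lemma hom_ofAlgebra_ext {Z : Presentation T.toFunctor} {M : T.Algebra} {f g : Z ⟶ ofAlgebra M}
    (h : f.gen = g.gen) : f = g :=
  hom_ext h (by rw [rel_eq, rel_eq, h])

/-- A step towards an algebra: a morphism `f : Z ⟶ Z'` such that `Z'` evaluates all terms over
the generators of `Z`, compatibly with the relations of `Z` and with the monad structure. -/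
structure Step {Z Z' : Presentation T.toFunctor} (f : Z ⟶ Z') where
  eval : T.obj Z.gen ⟶ Z'.rel
  term_eval : Z.term ≫ eval = f.rel
  eval_term : eval ≫ Z'.term = T.map f.gen
  unit_eval : T.η.app Z.gen ≫ eval ≫ Z'.val = f.gen
  map_val_eval : T.map Z.val ≫ eval ≫ Z'.val = T.map Z.term ≫ T.μ.app Z.gen ≫ eval ≫ Z'.val

variable (T) in
/-- The steps which do not affect the models of a presentation. -/
def steps : MorphismProperty (Presentation T.toFunctor) :=
  fun _ _ f => Nonempty (Step f) ∧ (algebras T).isLocal f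

section Succ

variable {Z : Presentation T.toFunctor}
  {c : Cofork (T.map Z.val) (T.map Z.term ≫ T.μ.app Z.gen)}

lemma val_unit_π (c : Cofork (T.map Z.val) (T.map Z.term ≫ T.μ.app Z.gen)) :
    Z.val ≫ T.η.app Z.gen ≫ c.π = Z.term ≫ c.π := by
  have h := c.condition
  have h₁ : Z.val ≫ T.η.app Z.gen = T.η.app Z.rel ≫ T.map Z.val := T.η.naturality Z.val
  have h₂ : Z.term ≫ T.η.app (T.obj Z.gen) = T.η.app Z.rel ≫ T.map Z.term :=
    T.η.naturality Z.term
  rw [reassoc_of% h₁, h, Category.assoc, ← reassoc_of% h₂, T.left_unit_assoc]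

/-- The presentation obtained by evaluating all terms over the generators of `Z`. -/
abbrev succ (c : Cofork (T.map Z.val) (T.map Z.term ≫ T.μ.app Z.gen)) :
    Presentation T.toFunctor where
  gen := c.pt
  rel := T.obj Z.gen
  val := c.π
  term := T.map (T.η.app Z.gen ≫ c.π)

/-- The canonical step. -/
abbrev toSucc (c : Cofork (T.map Z.val) (T.map Z.term ≫ T.μ.app Z.gen)) : Z ⟶ succ c where
  gen := T.η.app Z.gen ≫ c.π
  rel := Z.term
  val_comm := val_unit_π c
  term_comm := rfl

lemma steps_toSucc (hc : IsColimit c) : steps T (toSucc c) := by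
  refine ⟨⟨𝟙 _, Category.comp_id _, Category.id_comp _, ?_, ?_⟩, ?_⟩
  · rw [Category.id_comp]
  · rw [Category.id_comp, c.condition, Category.assoc]
  · rintro _ ⟨M, rfl⟩
    have key (g : succ c ⟶ ofAlgebra M) : c.π ≫ g.gen = T.map (toSucc c ≫ g).gen ≫ M.a := by
      rw [val_comp_gen g, comp_gen, T.map_comp, Category.assoc]
    refine ⟨fun g₁ g₂ h => hom_ofAlgebra_ext (Cofork.IsColimit.hom_ext hc ?_), fun g => ?_⟩
    · have h' : toSucc c ≫ g₁ = toSucc c ≫ g₂ := h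
      rw [key, key, h']
    · have hμ : T.μ.app Z.gen ≫ T.map g.gen ≫ M.a = T.map (T.map g.gen ≫ M.a) ≫ M.a := by
        have h : T.map (T.map g.gen) ≫ T.μ.app M.A = T.μ.app Z.gen ≫ T.map g.gen :=
          T.μ.naturality g.gen
        rw [← reassoc_of% h, M.assoc, T.map_comp, Category.assoc]
      have h : T.map Z.val ≫ T.map g.gen ≫ M.a =
          (T.map Z.term ≫ T.μ.app Z.gen) ≫ T.map g.gen ≫ M.a := by
        rw [Category.assoc, hμ, ← T.map_comp_assoc, ← T.map_comp_assoc, val_comp_gen]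
      obtain ⟨k, hk⟩ := Cofork.IsColimit.desc' hc _ h
      have hη : T.η.app Z.gen ≫ T.map g.gen ≫ M.a = g.gen := by
        have h : g.gen ≫ T.η.app M.A = T.η.app Z.gen ≫ T.map g.gen := T.η.naturality g.gen
        rw [← reassoc_of% h, M.unit, Category.comp_id]
      have hk' : (T.η.app Z.gen ≫ c.π) ≫ k = g.gen := by rw [Category.assoc, hk, hη]
      exact ⟨toOfAlgebra k (by rw [hk, ← T.map_comp_assoc, hk']), hom_ofAlgebra_ext hk'⟩

end Succ

section Convergence

variable {J : Type w} [LinearOrder J] [SuccOrder J] {F : J ⥤ Presentation T.toFunctor}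

lemma map_eval (e : ∀ j, Step (F.map (homOfLE (Order.le_succ j)))) {i j : J} (h : i ≤ j) :
    T.map (F.map (homOfLE h)).gen ≫ (e j).eval =
      (e i).eval ≫ (F.map (homOfLE (Order.succ_le_succ h))).rel := by
  obtain rfl | hij := h.eq_or_lt
  · have h₁ : homOfLE h = 𝟙 i := rfl
    have h₂ : homOfLE (Order.succ_le_succ h) = 𝟙 (Order.succ i) := rfl
    rw [h₁, h₂, F.map_id, F.map_id, id_gen, id_rel, T.map_id, Category.id_comp, Category.comp_id]
  · have hij' : Order.succ i ≤ j := Order.succ_le_of_lt hij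
    have h₁ : F.map (homOfLE h) = F.map (homOfLE (Order.le_succ i)) ≫ F.map (homOfLE hij') :=
      F.map_comp (homOfLE (Order.le_succ i)) (homOfLE hij')
    have h₂ : F.map (homOfLE (Order.succ_le_succ h)) =
        F.map (homOfLE hij') ≫ F.map (homOfLE (Order.le_succ j)) :=
      F.map_comp (homOfLE hij') (homOfLE (Order.le_succ j))
    rw [h₁, h₂, comp_gen, comp_rel, T.map_comp, ← (e i).eval_term, Category.assoc, Category.assoc,
      (F.map (homOfLE hij')).term_comm_assoc, (e j).term_eval]

/-- The cocone obtained by evaluating terms in a cocone of presentations. -/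
abbrev evalCocone (e : ∀ j, Step (F.map (homOfLE (Order.le_succ j)))) (c : Cocone F) :
    Cocone ((F ⋙ genFunctor T.toFunctor) ⋙ T.toFunctor) where
  pt := c.pt.rel
  ι :=
    { app := fun j => (e j).eval ≫ (c.ι.app (Order.succ j)).rel
      naturality := fun i j f => by
        have h : (F.map (homOfLE (Order.succ_le_succ (leOfHom f)))).rel ≫
            (c.ι.app (Order.succ j)).rel = (c.ι.app (Order.succ i)).rel :=
          congrArg Hom.rel (c.w (homOfLE (Order.succ_le_succ (leOfHom f))))
        have h' := map_eval e (leOfHom f)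
        exact ((reassoc_of% h') _).trans ((congrArg _ h).trans (Category.comp_id _).symm) }

/-- A presentation which is the colimit of a sequence of steps is the canonical presentation of
an algebra as soon as the monad preserves this colimit of generators. -/
lemma exists_iso_ofAlgebra (e : ∀ j, Step (F.map (homOfLE (Order.le_succ j)))) (c : Cocone F)
    (hgen : IsColimit ((genFunctor T.toFunctor).mapCocone c))
    (hrel : IsColimit ((relFunctor T.toFunctor).mapCocone c))
    (hT : IsColimit (T.mapCocone ((genFunctor T.toFunctor).mapCocone c)))
    (hTT : IsColimit (T.mapCocone (T.mapCocone ((genFunctor T.toFunctor).mapCocone c)))) :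
    ∃ X : T.Algebra, X.A = c.pt.gen ∧ Nonempty (c.pt ≅ ofAlgebra X) := by
  let d : T.obj c.pt.gen ⟶ c.pt.rel := hT.desc (evalCocone e c)
  have hd (j) : T.map (c.ι.app j).gen ≫ d = (e j).eval ≫ (c.ι.app (Order.succ j)).rel :=
    hT.fac (evalCocone e c) j
  have wgen (j) : (F.map (homOfLE (Order.le_succ j))).gen ≫ (c.ι.app (Order.succ j)).gen =
      (c.ι.app j).gen := congrArg Hom.gen (c.w (homOfLE (Order.le_succ j)))
  have wrel (j) : (F.map (homOfLE (Order.le_succ j))).rel ≫ (c.ι.app (Order.succ j)).rel =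
      (c.ι.app j).rel := congrArg Hom.rel (c.w (homOfLE (Order.le_succ j)))
  have hx (j) : T.map (c.ι.app j).gen ≫ d ≫ c.pt.val =
      (e j).eval ≫ (F.obj (Order.succ j)).val ≫ (c.ι.app (Order.succ j)).gen := by
    have h : (F.obj (Order.succ j)).val ≫ (c.ι.app (Order.succ j)).gen =
      (c.ι.app (Order.succ j)).rel ≫ c.pt.val := (c.ι.app (Order.succ j)).val_comm
    rw [reassoc_of% (hd j), h]
  have d_term : d ≫ c.pt.term = 𝟙 _ := hT.hom_ext fun j => by
    change T.map (c.ι.app j).gen ≫ d ≫ c.pt.term = T.map (c.ι.app j).gen ≫ 𝟙 _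
    have h : (F.obj (Order.succ j)).term ≫ T.map (c.ι.app (Order.succ j)).gen =
      (c.ι.app (Order.succ j)).rel ≫ c.pt.term := (c.ι.app (Order.succ j)).term_comm
    rw [reassoc_of% (hd j), ← h, ← Category.assoc, (e j).eval_term, ← T.map_comp, wgen,
      Category.comp_id]
  have term_d : c.pt.term ≫ d = 𝟙 _ := hrel.hom_ext fun j => by
    change (c.ι.app j).rel ≫ c.pt.term ≫ d = (c.ι.app j).rel ≫ 𝟙 _
    have h : (F.obj j).term ≫ T.map (c.ι.app j).gen =
      (c.ι.app j).rel ≫ c.pt.term := (c.ι.app j).term_comm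
    rw [← reassoc_of% h, hd, ← Category.assoc, (e j).term_eval, wrel, Category.comp_id]
  have unit : T.η.app c.pt.gen ≫ d ≫ c.pt.val = 𝟙 _ := hgen.hom_ext fun j => by
    change (c.ι.app j).gen ≫ T.η.app c.pt.gen ≫ d ≫ c.pt.val = (c.ι.app j).gen ≫ 𝟙 _
    have h : (c.ι.app j).gen ≫ T.η.app c.pt.gen = T.η.app _ ≫ T.map (c.ι.app j).gen :=
      T.η.naturality _
    have h' := (e j).unit_eval
    simp only [← Category.assoc] at h'
    rw [reassoc_of% h, hx]
    simp only [← Category.assoc]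
    rw [h', wgen, Category.comp_id]
  have assoc : T.μ.app c.pt.gen ≫ d ≫ c.pt.val = T.map (d ≫ c.pt.val) ≫ d ≫ c.pt.val :=
    hTT.hom_ext fun j => by
      change T.map (T.map (c.ι.app j).gen) ≫ T.μ.app c.pt.gen ≫ d ≫ c.pt.val =
        T.map (T.map (c.ι.app j).gen) ≫ T.map (d ≫ c.pt.val) ≫ d ≫ c.pt.val
      have h : T.map (T.map (c.ι.app j).gen) ≫ T.μ.app c.pt.gen =
          T.μ.app _ ≫ T.map (c.ι.app j).gen := T.μ.naturality _
      have h' : T.map (T.map (F.map (homOfLE (Order.le_succ j))).gen) ≫ T.μ.app _ =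
          T.μ.app _ ≫ T.map (F.map (homOfLE (Order.le_succ j))).gen := T.μ.naturality _
      have hm := (e (Order.succ j)).map_val_eval
      have hl : T.μ.app _ ≫ T.map (c.ι.app j).gen ≫ d ≫ c.pt.val =
          T.map (T.map (F.map (homOfLE (Order.le_succ j))).gen) ≫ T.μ.app _ ≫
            T.map (c.ι.app (Order.succ j)).gen ≫ d ≫ c.pt.val := by
        rw [reassoc_of% h', ← T.map_comp_assoc, wgen]
      rw [reassoc_of% h, hl, hx (Order.succ j), ← (e j).eval_term, T.map_comp, Category.assoc,
        ← T.map_comp_assoc (T.map _), hx j, T.map_comp, T.map_comp, Category.assoc,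
        Category.assoc, hx (Order.succ j)]
      exact congrArg _ ((reassoc_of% hm) _).symm
  refine ⟨⟨c.pt.gen, d ≫ c.pt.val, unit, assoc⟩, rfl, ⟨?_⟩⟩
  exact
    { hom := ⟨𝟙 _, c.pt.term, by rw [reassoc_of% term_d, Category.comp_id], by
        rw [T.map_id]⟩
      inv := ⟨𝟙 _, d, Category.comp_id _, by rw [d_term, T.map_id, Category.comp_id]⟩
      hom_inv_id := hom_ext (Category.comp_id _) term_d
      inv_hom_id := hom_ext (Category.comp_id _) d_term }

end Convergence

variable {P : ObjectProperty D}

lemma exists_steps (hP : ∀ (K : Type t) [SmallCategory K], HasColimitsIn P K)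
    (hPT : ∀ X, P X → P (T.obj X)) (Z : Presentation T.toFunctor) (hZ : lift T.toFunctor P Z) :
    ∃ (Z' : Presentation T.toFunctor) (f : Z ⟶ Z'), lift T.toFunctor P Z' ∧ steps T f := by
  have h : HasColimitsIn P WalkingParallelPair :=
    (hP (AsSmall.{t} WalkingParallelPair)).of_equivalence AsSmall.equiv
  obtain ⟨c, ⟨hc⟩, hcP⟩ := h (parallelPair (T.map Z.val) (T.map Z.term ≫ T.μ.app Z.gen)) (by
    rintro (_ | _)
    exacts [hPT _ hZ.2, hPT _ hZ.1])
  exact ⟨succ c, toSucc c, ⟨hcP, hPT _ hZ.1⟩, steps_toSucc hc⟩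

/-- Presentations have reflections in algebras. -/
lemma exists_isLocal (hP : ∀ (K : Type t) [SmallCategory K], HasColimitsIn P K)
    (hPT : ∀ X, P X → P (T.obj X)) {κ : Cardinal.{t}} (hκ : κ.IsRegular)
    (hT : ∀ F : κ.ord.ToType ⥤ D, (∀ j, P (F.obj j)) → PreservesColimit F T.toFunctor)
    (Z : Presentation T.toFunctor) (hZ : lift T.toFunctor P Z) :
    ∃ (X : T.Algebra) (f : Z ⟶ ofAlgebra X), P X.A ∧ (algebras T).isLocal f := by
  have : Nonempty κ.ord.ToType := by simpa using hκ.ne_zero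
  have := WellFoundedLT.toOrderBot κ.ord.ToType
  have := Cardinal.noMaxOrder hκ.aleph0_le
  obtain ⟨Z', f, h, hZ', hF⟩ := HasColimitsIn.exists_transfiniteComposition
    (fun K => hasColimitsIn_lift (hP K)) (steps T) (exists_steps hP hPT) κ.ord.ToType hZ
  have e (j) : Step (h.F.map (homOfLE (Order.le_succ j))) :=
    (h.map_mem j (not_isMax j)).1.some
  have := preservesColimit_genFunctor (hP _) hF
  have := preservesColimit_relFunctor (hP _) hF
  have := hT (h.F ⋙ genFunctor T.toFunctor) (fun j => (hF j).1)
  have := hT ((h.F ⋙ genFunctor T.toFunctor) ⋙ T.toFunctor) (fun j => hPT _ (hF j).1)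
  have hgen := isColimitOfPreserves (genFunctor T.toFunctor) h.isColimit
  have hrel := isColimitOfPreserves (relFunctor T.toFunctor) h.isColimit
  have hTgen := isColimitOfPreserves T.toFunctor hgen
  obtain ⟨X, hX, ⟨i⟩⟩ := exists_iso_ofAlgebra e _ hgen hrel hTgen
    (isColimitOfPreserves T.toFunctor hTgen)
  have hf : (algebras T).isLocal f :=
    (algebras T).isLocal.transfiniteCompositionsOfShape_le _ _
      ⟨h.ofLE fun _ _ _ hg => hg.2⟩
  exact ⟨X, f ≫ i.hom, hX ▸ hZ'.1, MorphismProperty.RespectsIso.postcomp _ _ _ hf⟩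

end Presentation

open Presentation in
/-- If a monad is compatible with a class `P` of objects closed under colimits and preserves
colimits of `κ`-sequences in it, algebras with underlying object in `P` have colimits. -/
lemma exists_isColimit_algebra {P : ObjectProperty D}
    (hP : ∀ (K : Type t) [SmallCategory K], HasColimitsIn P K)
    (hPT : ∀ X, P X → P (T.obj X)) {κ : Cardinal.{t}} (hκ : κ.IsRegular)
    (hT : ∀ F : κ.ord.ToType ⥤ D, (∀ j, P (F.obj j)) → PreservesColimit F T.toFunctor)
    {J : Type t} [SmallCategory J] (F : J ⥤ T.Algebra) (hF : ∀ j, P (F.obj j).A) :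
    ∃ c : Cocone F, Nonempty (IsColimit c) ∧ P c.pt.A := by
  obtain ⟨c, ⟨hc⟩, hcP⟩ := hP J (F ⋙ T.forget) hF
  obtain ⟨d, ⟨hd⟩, hdP⟩ := hP J ((F ⋙ T.forget) ⋙ T.toFunctor) (fun j => hPT _ (hF j))
  let ι (j : J) : (F.obj j).A ⟶ c.pt := c.ι.app j
  let δ (j : J) : T.obj (F.obj j).A ⟶ d.pt := d.ι.app j
  have w {i j : J} (f : i ⟶ j) : (F.map f).f ≫ ι j = ι i := c.w f
  have ι_ext {Y : D} {g₁ g₂ : c.pt ⟶ Y} (h : ∀ j, ι j ≫ g₁ = ι j ≫ g₂) : g₁ = g₂ := hc.hom_ext h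
  have δ_ext {Y : D} {g₁ g₂ : d.pt ⟶ Y} (h : ∀ j, δ j ≫ g₁ = δ j ≫ g₂) : g₁ = g₂ := hd.hom_ext h
  obtain ⟨p, hp⟩ : ∃ p : d.pt ⟶ c.pt, ∀ j, δ j ≫ p = (F.obj j).a ≫ ι j :=
    ⟨hd.desc ⟨c.pt,
      { app := fun j => (F.obj j).a ≫ ι j
        naturality := fun i j f => by
          have h : T.map (F.map f).f ≫ (F.obj j).a ≫ ι j = (F.obj i).a ≫ ι i := by
            rw [(F.map f).h_assoc, w]
          exact h.trans (Category.comp_id _).symm }⟩, fun j => hd.fac _ j⟩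
  obtain ⟨q, hq⟩ : ∃ q : d.pt ⟶ T.obj c.pt, ∀ j, δ j ≫ q = T.map (ι j) :=
    ⟨hd.desc (T.mapCocone c), fun j => hd.fac _ j⟩
  obtain ⟨X, f, hX, hf⟩ := exists_isLocal hP hPT hκ hT ⟨c.pt, d.pt, p, q⟩ ⟨hcP, hdP⟩
  have hpf : p ≫ f.gen = q ≫ T.map f.gen ≫ X.a := val_comp_gen f
  let leg (j : J) : F.obj j ⟶ X :=
    { f := ι j ≫ f.gen
      h := by
        have h := hp j
        rw [T.map_comp, Category.assoc, ← hq, Category.assoc, ← hpf, ← Category.assoc, h,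
          Category.assoc] }
  let c' : Cocone F :=
    { pt := X
      ι :=
        { app := leg
          naturality := fun i j g => by
            ext
            change (F.map g).f ≫ ι j ≫ f.gen = (ι i ≫ f.gen) ≫ 𝟙 _
            rw [← Category.assoc, w, Category.comp_id] } }
  refine ⟨c', ⟨IsColimit.ofExistsUnique fun s => ?_⟩, hX⟩
  obtain ⟨g, hg⟩ : ∃ g : c.pt ⟶ s.pt.A, ∀ j, ι j ≫ g = (s.ι.app j).f :=
    ⟨hc.desc (T.forget.mapCocone s), fun j => hc.fac _ j⟩
  have hpg : p ≫ g = q ≫ T.map g ≫ s.pt.a := δ_ext fun j => by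
    have h : T.map (s.ι.app j).f ≫ s.pt.a = (F.obj j).a ≫ (s.ι.app j).f := (s.ι.app j).h
    rw [← Category.assoc, hp, Category.assoc, hg, ← Category.assoc (δ j), hq,
      ← T.map_comp_assoc, hg, h]
  obtain ⟨hinj, hsurj⟩ := hf (ofAlgebra s.pt) ⟨_, rfl⟩
  obtain ⟨k, hk⟩ := hsurj (toOfAlgebra g hpg)
  have hk' : f.gen ≫ k.gen = g := congrArg Hom.gen hk
  have hka : X.a ≫ k.gen = T.map k.gen ≫ s.pt.a := by rw [val_comp_gen k, Category.id_comp]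
  refine ⟨⟨k.gen, hka.symm⟩, fun j => ?_, fun m hm => ?_⟩
  · ext
    change (ι j ≫ f.gen) ≫ k.gen = _
    rw [Category.assoc, hk', hg]
  · let m' : ofAlgebra X ⟶ ofAlgebra s.pt := toOfAlgebra m.f (by rw [Category.id_comp, m.h])
    have hm' : m' = k := hinj (hom_ofAlgebra_ext (ι_ext fun j => by
      have h : (ι j ≫ f.gen) ≫ m.f = (s.ι.app j).f := congrArg Monad.Algebra.Hom.f (hm j)
      change ι j ≫ f.gen ≫ m.f = ι j ≫ f.gen ≫ k.gen
      rw [hk', hg, ← h, Category.assoc]))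
    ext
    exact congrArg Hom.gen hm'

end Reflection
section Pointed

variable {C : Type u₁} [Category.{v₁} C] {A : C ⥤ G} {T : Monad C} {B : G}

variable (A B) in
/-- The objects of the fiber over `B`, among the objects equipped with a morphism from `B` to their
arity. -/
def fiber : ObjectProperty (StructuredArrow B A) :=
  fun X => ∃ h : B = A.obj X.right, X.hom = eqToHom h

lemma map_right_of_fiber {X Y : StructuredArrow B A} (hX : fiber A B X) (hY : fiber A B Y)
    (f : X ⟶ Y) : A.map f.right = eqToHom (hX.1.symm.trans hY.1) := by
  have h := StructuredArrow.w f
  rw [hX.2, hY.2] at h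
  rw [← cancel_epi (eqToHom hX.1), h, eqToHom_trans]

section Colimit

variable {J : Type w} [Category.{w'} J] {F : J ⥤ StructuredArrow B A}

lemma arityConst_of_fiber (hF : ∀ j, fiber A B (F.obj j)) :
    ArityConst A (F ⋙ StructuredArrow.proj B A) B where
  obj_eq j := (hF j).1.symm
  map_eq f := map_right_of_fiber (hF _) (hF _) (F.map f)

/-- The surcocone underlying a cocone of objects of the fiber. -/
abbrev surcocone (hF : ∀ j, fiber A B (F.obj j)) (c : Cocone F) :
    Surcocone A (F ⋙ StructuredArrow.proj B A) B (arityConst_of_fiber hF).obj_eq where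
  pt := c.pt.right
  leg j := (c.ι.app j).right
  w f := congrArg CommaMorphism.right (c.w f)
  arity := c.pt.hom
  fac j := by
    have h : (F.obj j).hom ≫ A.map (c.ι.app j).right = c.pt.hom := StructuredArrow.w (c.ι.app j)
    rw [← h, (hF j).2]
    rfl

/-- The cocone given by a surcocone of objects of the fiber. -/
abbrev coconeOfSurcocone (hF : ∀ j, fiber A B (F.obj j))
    (s : Surcocone A (F ⋙ StructuredArrow.proj B A) B (arityConst_of_fiber hF).obj_eq) :
    Cocone F where
  pt := StructuredArrow.mk s.arity
  ι :=
    { app := fun j => StructuredArrow.homMk (s.leg j) (by rw [(hF j).2]; exact s.fac j)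
      naturality := fun i j f => by
        ext
        exact (s.w f).trans (Category.comp_id _).symm }

lemma nonempty_isColimit_of_isSurcolimit (hF : ∀ j, fiber A B (F.obj j)) {c : Cocone F}
    (hc : IsSurcolimit A (surcocone hF c)) : Nonempty (IsColimit c) := by
  refine ⟨IsColimit.ofExistsUnique fun s => ?_⟩
  obtain ⟨f, ⟨hf, hf'⟩, hu⟩ := hc.desc (surcocone hF s)
  have harity : c.pt.hom = eqToHom hc.pt_eq.symm := hc.arity_eq
  refine ⟨StructuredArrow.homMk f (by rw [harity, hf']), fun j => ?_, fun g hg => ?_⟩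
  · ext
    exact hf j
  · ext
    refine hu _ ⟨fun j => congrArg CommaMorphism.right (hg j), ?_⟩
    rw [← harity]
    exact StructuredArrow.w g

lemma fiber_of_isSurcolimit (hF : ∀ j, fiber A B (F.obj j)) {c : Cocone F}
    (hc : IsSurcolimit A (surcocone hF c)) : fiber A B c.pt :=
  ⟨hc.pt_eq.symm, hc.arity_eq⟩

lemma hasColimitsIn_fiber (h : HasSurcolimitsOfShape A J) : HasColimitsIn (fiber A B) J := by
  intro F hF
  obtain ⟨s, hs⟩ := h _ B (arityConst_of_fiber hF)
  have hc : IsSurcolimit A (surcocone hF (coconeOfSurcocone hF s)) := hs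
  exact ⟨_, nonempty_isColimit_of_isSurcolimit hF hc, fiber_of_isSurcolimit hF hc⟩

end Colimit

variable (A T B) in
/-- The monad induced by `T` on the objects equipped with a morphism from `B` to their arity. -/
abbrev pointedMonad : Monad (StructuredArrow B A) where
  obj X := StructuredArrow.mk (X.hom ≫ A.map (T.η.app X.right))
  map {X Y} f := StructuredArrow.homMk (T.map f.right) (by
    have h : f.right ≫ T.η.app Y.right = T.η.app X.right ≫ T.map f.right :=
      T.η.naturality f.right
    have h' := StructuredArrow.w f
    simp only [StructuredArrow.mk_hom_eq_self, StructuredArrow.mk_right]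
    rw [Category.assoc, ← A.map_comp, ← h, A.map_comp, reassoc_of% h'])
  map_id X := by
    ext
    exact T.map_id _
  map_comp f g := by
    ext
    exact T.map_comp _ _
  η :=
    { app := fun X => StructuredArrow.homMk (T.η.app X.right)
      naturality := fun X Y f => by
        ext
        exact T.η.naturality _ }
  μ :=
    { app := fun X => StructuredArrow.homMk (T.μ.app X.right) (by
        change ((X.hom ≫ A.map (T.η.app X.right)) ≫ A.map (T.η.app (T.obj X.right))) ≫
          A.map (T.μ.app X.right) = X.hom ≫ A.map (T.η.app X.right)
        have h : A.map (T.η.app (T.obj X.right)) ≫ A.map (T.μ.app X.right) = 𝟙 _ := by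
          rw [← A.map_comp, T.left_unit]
          exact A.map_id _
        rw [Category.assoc, h]
        exact Category.comp_id _)
      naturality := fun X Y f => by
        ext
        exact T.μ.naturality _ }
  left_unit X := by
    ext
    exact T.left_unit _
  right_unit X := by
    ext
    exact T.right_unit _
  assoc X := by
    ext
    exact T.assoc _

lemma IsSurmonad.fiber_obj (hT : IsSurmonad A T) (X : StructuredArrow B A) (hX : fiber A B X) :
    fiber A B ((pointedMonad A T B).obj X) := by
  refine ⟨hX.1.trans (Functor.congr_obj hT.sur X.right).symm, ?_⟩
  change X.hom ≫ A.map (T.η.app X.right) = _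
  rw [hX.2, hT.unit_arity, eqToHom_trans]

lemma preservesColimit_pointedMonad (hT : IsSurmonad A T) {J : Type w} [Category.{w'} J]
    (h : HasSurcolimitsOfShape A J) (hpres : PreservesSurcolimitsOfShape T.toFunctor hT.sur J)
    (F : J ⥤ StructuredArrow B A) (hF : ∀ j, fiber A B (F.obj j)) :
    PreservesColimit F (pointedMonad A T B).toFunctor := by
  obtain ⟨s, hs⟩ := h _ B (arityConst_of_fiber hF)
  have hs' := hpres _ B (arityConst_of_fiber hF) s hs
  have hc : IsSurcolimit A (surcocone hF (coconeOfSurcocone hF s)) := hs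
  have hF' (j) : fiber A B ((F ⋙ (pointedMonad A T B).toFunctor).obj j) := hT.fiber_obj _ (hF j)
  have harity : s.arity ≫ A.map (T.η.app s.pt) = eqToHom hs'.pt_eq.symm := by
    rw [hT.unit_arity]
    exact hs'.arity_eq
  have hc' : IsSurcolimit A
      (surcocone hF' ((pointedMonad A T B).mapCocone (coconeOfSurcocone hF s))) :=
    ⟨hs'.pt_eq, harity, hs'.desc⟩
  exact preservesColimit_of_preserves_colimit_cocone
    (nonempty_isColimit_of_isSurcolimit hF hc).some
    (nonempty_isColimit_of_isSurcolimit hF' hc').some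

/-- An algebra equipped with a morphism to its arity, as an algebra over the induced monad. -/
abbrev pointedAlgebra (M : T.Algebra) (b : B ⟶ A.obj M.A) : (pointedMonad A T B).Algebra where
  A := StructuredArrow.mk b
  a := StructuredArrow.homMk M.a (by
    change (b ≫ A.map (T.η.app M.A)) ≫ A.map M.a = b
    rw [Category.assoc, ← A.map_comp, M.unit, A.map_id, Category.comp_id])
  unit := by
    ext
    exact M.unit
  assoc := by
    ext
    exact M.assoc

/-- Morphisms between algebras over the induced monad. -/
abbrev pointedHom {M N : T.Algebra} {b : B ⟶ A.obj M.A} {b' : B ⟶ A.obj N.A} (f : M ⟶ N)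
    (h : b ≫ A.map f.f = b') : pointedAlgebra M b ⟶ pointedAlgebra N b' where
  f := StructuredArrow.homMk f.f h
  h := by
    ext
    exact f.h

variable (A T B) in
/-- The functor forgetting the morphism from `B` to the arity of an algebra. -/
abbrev forgetPoint : (pointedMonad A T B).Algebra ⥤ T.Algebra where
  obj X :=
    { A := X.A.right
      a := X.a.right
      unit := congrArg CommaMorphism.right X.unit
      assoc := congrArg CommaMorphism.right X.assoc }
  map f :=
    { f := f.f.right
      h := congrArg CommaMorphism.right f.h }

/-- A diagram of algebras with constant arity `B`, as a diagram of algebras over the induced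
monad. -/
abbrev pointedDiagram {J : Type w} [Category.{w'} J] {F : J ⥤ T.Algebra}
    (hF : ArityConst (T.forget ⋙ A) F B) : J ⥤ (pointedMonad A T B).Algebra where
  obj j := pointedAlgebra (F.obj j) (eqToHom (hF.obj_eq j).symm)
  map f := pointedHom (F.map f)
    ((congrArg (eqToHom (hF.obj_eq _).symm ≫ ·) (hF.map_eq f)).trans (eqToHom_trans _ _))
  map_id j := by
    ext
    exact congrArg Monad.Algebra.Hom.f (F.map_id j)
  map_comp f g := by
    ext
    exact congrArg Monad.Algebra.Hom.f (F.map_comp f g)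

lemma exists_isSurcolimit {J : Type w} [Category.{w'} J] {F : J ⥤ T.Algebra}
    (hF : ArityConst (T.forget ⋙ A) F B) (c : Cocone (pointedDiagram hF)) (hc : IsColimit c)
    (hcB : fiber A B c.pt.A) :
    ∃ s : Surcocone (T.forget ⋙ A) F B hF.obj_eq, IsSurcolimit (T.forget ⋙ A) s := by
  let s : Surcocone (T.forget ⋙ A) F B hF.obj_eq :=
    { pt := (forgetPoint A T B).obj c.pt
      leg := fun j => (forgetPoint A T B).map (c.ι.app j)
      w := fun f => congrArg (forgetPoint A T B).map (c.w f)
      arity := c.pt.A.hom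
      fac := fun j => StructuredArrow.w (c.ι.app j).f }
  refine ⟨s, hcB.1.symm, hcB.2, fun s' => ?_⟩
  let c' : Cocone (pointedDiagram hF) :=
    { pt := pointedAlgebra s'.pt s'.arity
      ι :=
        { app := fun j => pointedHom (s'.leg j) (s'.fac j)
          naturality := fun i j f => by
            ext
            exact (congrArg Monad.Algebra.Hom.f (s'.w f)).trans (Category.comp_id _).symm } }
  refine ⟨(forgetPoint A T B).map (hc.desc c'), ⟨fun j => ?_, ?_⟩, ?_⟩
  · exact congrArg (forgetPoint A T B).map (hc.fac c' j)
  · have h := StructuredArrow.w (hc.desc c').f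
    rw [hcB.2] at h
    exact h
  · rintro g ⟨hg, hg'⟩
    let g' : c.pt ⟶ c'.pt :=
      { f := StructuredArrow.homMk g.f (by rw [hcB.2]; exact hg')
        h := by
          ext
          exact g.h }
    have h : g' = hc.desc c' := hc.uniq c' g' fun j => by
      ext
      exact congrArg Monad.Algebra.Hom.f (hg j)
    exact congrArg (forgetPoint A T B).map h

end Pointed

section Cardinal

universe t

lemma isCardinalFilteredCat_ord_toType {κ : Cardinal.{t}} (hκ : κ.IsRegular) :
    IsCardinalFilteredCat κ.ord.ToType κ := by
  intro K _ _ hK D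
  have : Fact κ.IsRegular := ⟨hκ⟩
  have hK' : HasCardinalLT (Arrow K) κ := by
    rw [hasCardinalLT_iff_of_equiv (Arrow.equivSigma K), hasCardinalLT_iff_cardinal_mk_lt]
    exact hK
  let c := IsCardinalFiltered.cocone D hK'
  exact ⟨c.pt, c.ι.app, fun f => c.w f⟩

end Cardinal


section Creation

variable {C : Type u₁} [Category.{v₁} C] {A : C ⥤ G} {T : Monad C}

lemma IsSurmonad.map_map (hT : IsSurmonad A T) {X Y : C} (f : X ⟶ Y) :
    A.map (T.map f) = eqToHom (Functor.congr_obj hT.sur X) ≫ A.map f ≫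
      eqToHom (Functor.congr_obj hT.sur Y).symm :=
  Functor.congr_hom hT.sur f

lemma IsSurmonad.map_a (hT : IsSurmonad A T) (M : T.Algebra) :
    A.map M.a = eqToHom (Functor.congr_obj hT.sur M.A) := by
  have h : A.map (T.η.app M.A) ≫ A.map M.a = 𝟙 _ := by
    rw [← A.map_comp, M.unit]
    exact A.map_id _
  rw [hT.unit_arity] at h
  rw [← cancel_epi (eqToHom (Functor.congr_obj hT.sur M.A).symm), eqToHom_trans]
  exact h

lemma IsSurmonad.map_map_comp_a (hT : IsSurmonad A T) {X : C} {M : T.Algebra} (f : X ⟶ M.A) :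
    A.map (T.map f ≫ M.a) = eqToHom (Functor.congr_obj hT.sur X) ≫ A.map f := by
  rw [A.map_comp, hT.map_map, hT.map_a, Category.assoc, Category.assoc, eqToHom_trans,
    eqToHom_refl, Category.comp_id]

lemma HasKEqualizers.forget_comp (T : Monad C) (hK : HasKEqualizers A) :
    HasKEqualizers (T.forget ⋙ A) := by
  intro M N f g hfg
  obtain ⟨X, e, hX, he, hw, hu⟩ := hK f.f g.f hfg
  have mono {Y : C} {k l : Y ⟶ X} (h : k ≫ e = l ≫ e) : k = l := by
    obtain ⟨m, -, hm⟩ := hu (l ≫ e) (by rw [Category.assoc, Category.assoc, hw])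
    rw [hm k h, hm l rfl]
  obtain ⟨x, hx, -⟩ := hu (T.map e ≫ M.a) (by
    rw [Category.assoc, Category.assoc, ← f.h, ← g.h, ← T.map_comp_assoc, ← T.map_comp_assoc, hw])
  let L : T.Algebra :=
    { A := X
      a := x
      unit := mono (by
        have h : e ≫ T.η.app M.A = T.η.app X ≫ T.map e := T.η.naturality e
        rw [Category.assoc, hx, ← reassoc_of% h, M.unit]
        exact (Category.comp_id _).trans (Category.id_comp _).symm)
      assoc := mono (by
        have h : T.map (T.map e) ≫ T.μ.app M.A = T.μ.app X ≫ T.map e := T.μ.naturality e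
        rw [Category.assoc, Category.assoc, hx, ← reassoc_of% h, M.assoc, ← T.map_comp_assoc,
          ← hx, T.map_comp_assoc, hx]) }
  refine ⟨L, ⟨e, hx.symm⟩, hX, he, ?_, fun N' k hk => ?_⟩
  · ext
    exact hw
  · have hk' : k.f ≫ f.f = k.f ≫ g.f := congrArg Monad.Algebra.Hom.f hk
    obtain ⟨l, hl, hl'⟩ := hu k.f hk'
    refine ⟨⟨l, mono ?_⟩, ?_, fun m hm => ?_⟩
    · change (T.map l ≫ x) ≫ e = (N'.a ≫ l) ≫ e
      rw [Category.assoc, Category.assoc, hx, hl, ← k.h, ← hl, T.map_comp_assoc]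
    · ext
      exact hl
    · ext
      exact hl' _ (congrArg Monad.Algebra.Hom.f hm)

lemma IsSurmonad.hasSurlimitsOfShape (hT : IsSurmonad A T) {J : Type w} [Category.{w'} J]
    (h : HasSurlimitsOfShape A J) : HasSurlimitsOfShape (T.forget ⋙ A) J := by
  intro F B hF
  have hF' : ArityConst A (F ⋙ T.forget) B := ⟨hF.obj_eq, hF.map_eq⟩
  obtain ⟨c, hc⟩ := h (F ⋙ T.forget) B hF'
  let leg (j : J) : c.pt ⟶ (F.obj j).A := c.leg j
  have leg_w {i j : J} (f : i ⟶ j) : leg i ≫ (F.map f).f = leg j := c.w f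
  have leg_fac (j : J) : A.map (leg j) ≫ eqToHom (hF.obj_eq j) = eqToHom hc.pt_eq :=
    (c.fac j).trans hc.arity_eq
  have exists_lift {Y : C} (b : A.obj Y ⟶ B) (k : ∀ j, Y ⟶ (F.obj j).A)
      (hk : ∀ {i j : J} (f : i ⟶ j), k i ≫ (F.map f).f = k j)
      (hb : ∀ j, A.map (k j) ≫ eqToHom (hF.obj_eq j) = b) :
      ∃ l : Y ⟶ c.pt, (∀ j, l ≫ leg j = k j) ∧ A.map l ≫ eqToHom hc.pt_eq = b :=
    (hc.lift ⟨Y, k, hk, b, hb⟩).exists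
  have hom_ext {Y : C} {k l : Y ⟶ c.pt} (h : ∀ j, k ≫ leg j = l ≫ leg j)
      (hA : A.map k = A.map l) : k = l :=
    (hc.lift ⟨Y, fun j => l ≫ leg j, fun f => (Category.assoc _ _ _).trans
      (congrArg (l ≫ ·) (leg_w f)), A.map l ≫ eqToHom hc.pt_eq, fun j => by
        rw [A.map_comp, Category.assoc]
        exact congrArg (A.map l ≫ ·) (leg_fac j)⟩).unique
        ⟨h, congrArg (· ≫ eqToHom hc.pt_eq) hA⟩ ⟨fun _ => rfl, rfl⟩
  obtain ⟨x, hx, hxA⟩ := exists_lift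
    (eqToHom (Functor.congr_obj hT.sur c.pt) ≫ eqToHom hc.pt_eq)
    (fun j => T.map (leg j) ≫ (F.obj j).a)
    (fun {i j} f => by
      rw [Category.assoc, ← (F.map f).h, ← T.map_comp_assoc, leg_w])
    (fun j => by rw [hT.map_map_comp_a, Category.assoc]; exact congrArg _ (leg_fac j))
  have hxA' : A.map x = eqToHom (Functor.congr_obj hT.sur c.pt) := by
    rwa [cancel_mono] at hxA
  let L : T.Algebra :=
    { A := c.pt
      a := x
      unit := hom_ext (fun j => by
        have h : leg j ≫ T.η.app _ = T.η.app c.pt ≫ T.map (leg j) := T.η.naturality (leg j)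
        rw [Category.assoc, hx, ← reassoc_of% h, (F.obj j).unit]
        exact (Category.comp_id _).trans (Category.id_comp _).symm) (by
        rw [A.map_comp, hT.unit_arity, hxA', eqToHom_trans]
        exact (A.map_id _).symm)
      assoc := hom_ext (fun j => by
        have h : T.map (T.map (leg j)) ≫ T.μ.app _ = T.μ.app c.pt ≫ T.map (leg j) :=
          T.μ.naturality (leg j)
        rw [Category.assoc, Category.assoc, hx, ← reassoc_of% h, (F.obj j).assoc,
          ← T.map_comp_assoc, ← hx, T.map_comp_assoc, hx]) (by
        rw [A.map_comp, A.map_comp, hT.mul_arity, hT.map_map, hxA', eqToHom_trans, eqToHom_trans,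
          eqToHom_trans, eqToHom_trans]) }
  refine ⟨⟨L, fun j => ⟨leg j, (hx j).symm⟩, fun f => ?_, c.arity, c.fac⟩,
    hc.pt_eq, hc.arity_eq, fun s => ?_⟩
  · ext
    exact leg_w f
  obtain ⟨l, hl, hlA⟩ := exists_lift (Y := s.pt.A) s.arity (fun j => (s.leg j).f)
    (fun f => congrArg Monad.Algebra.Hom.f (s.w f)) s.fac
  refine ⟨⟨l, hom_ext (fun j => ?_) ?_⟩, ⟨fun j => ?_, hlA⟩, fun m hm => ?_⟩
  · change (T.map l ≫ x) ≫ leg j = (s.pt.a ≫ l) ≫ leg j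
    rw [Category.assoc, Category.assoc, hx, hl, ← (s.leg j).h, ← hl, T.map_comp_assoc]
  · change A.map (T.map l ≫ x) = A.map (s.pt.a ≫ l)
    rw [A.map_comp, A.map_comp, hT.map_map, hxA', hT.map_a, Category.assoc, Category.assoc,
      eqToHom_trans, eqToHom_refl, Category.comp_id]
  · ext
    exact hl j
  · ext
    refine hom_ext (fun j => (congrArg Monad.Algebra.Hom.f (hm.1 j)).trans (hl j).symm) ?_
    rw [← cancel_mono (eqToHom hc.pt_eq)]
    exact hm.2.trans hlA.symm

end Creation
universe s

/-- **Barr–Wells's Surcategorical Theorem.** -/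
theorem barr_wells_surcategorical
    {G : Type u} [Category.{v} G] {C : Type u₁} [Category.{v₁} C]
    (A : C ⥤ G) (T : Monad C) (hT : IsSurmonad A T)
    (hcompl : ∀ (J : Type s) [SmallCategory J], HasSurlimitsOfShape A J)
    (hcocompl : ∀ (J : Type s) [SmallCategory J], HasSurcolimitsOfShape A J)
    (hK : HasKEqualizers A)
    (κ : Cardinal.{s}) (hreg : κ.IsRegular)
    (hpres : ∀ (J : Type s) [SmallCategory J], IsCardinalFilteredCat J κ →
      PreservesSurcolimitsOfShape T.toFunctor hT.sur J) :
    (∀ (J : Type s) [SmallCategory J], HasSurlimitsOfShape (T.forget ⋙ A) J) ∧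
    (∀ (J : Type s) [SmallCategory J], HasSurcolimitsOfShape (T.forget ⋙ A) J) ∧
    HasKEqualizers (T.forget ⋙ A) := by
  refine ⟨fun J _ => hT.hasSurlimitsOfShape (hcompl J), fun J _ F B hF => ?_, hK.forget_comp T⟩
  obtain ⟨c, ⟨hc⟩, hcB⟩ := exists_isColimit_algebra (T := pointedMonad A T B) (P := fiber A B)
    (fun K _ => hasColimitsIn_fiber (hcocompl K)) hT.fiber_obj hreg
    (preservesColimit_pointedMonad hT (hcocompl _)
      (hpres _ (isCardinalFilteredCat_ord_toType hreg)))
    (pointedDiagram hF) (fun j => ⟨(hF.obj_eq j).symm, rfl⟩)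
  exact exists_isSurcolimit hF c hc hcB

end Sur
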